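/- arXiv:2311.07677 — 2 statements merged into one kernel-verified Lean document; each statement's English description precedes it below -/
import Mathlib

section
/- Let A ∈ ℂ^{m×n} be a nonzero matrix, q ≥ 2 a real number, r_1,…,r_m ∈ ℂ^n the conjugate transposes of the m rows of A, v ∈ ℂ^n a right singular vector corresponding to the largest singular value of A (i.e. v ≠ 0 and ‖Av‖_2 = ‖A‖_{2→2}‖v‖_2), and S = {v, r_1, …, r_m}. Then max_{x ∈ S, x ≠ 0} ‖Ax‖_q/‖x‖_2 ≥ (2 m^{1/q})^{−(q−2)/(2(q−1))} · ‖A‖_{2→q}. -/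
open scoped BigOperators

/-- The `ℓ_p` norm of a vector, for a real exponent `p`. -/
noncomputable def lpnorm {n : ℕ} {𝕜 : Type*} [RCLike 𝕜] (p : ℝ) (x : Fin n → 𝕜) : ℝ :=
  (∑ i, ‖x i‖ ^ p) ^ (1 / p)

/-- The `ℓ_∞` norm of a vector. -/
noncomputable def linorm {n : ℕ} {𝕜 : Type*} [RCLike 𝕜] (x : Fin n → 𝕜) : ℝ :=
  ⨆ i, ‖x i‖

/-- The `p → q` operator norm of a matrix: `max_{x ≠ 0} ‖Ax‖_q / ‖x‖_p`. -/
noncomputable def opNorm {m n : ℕ} {𝕜 : Type*} [RCLike 𝕜] (p q : ℝ)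
    (A : Matrix (Fin m) (Fin n) 𝕜) : ℝ :=
  ⨆ x : {x : Fin n → 𝕜 // x ≠ 0}, lpnorm q (A.mulVec x.1) / lpnorm p x.1

/-- The `p → ∞` operator norm of a matrix: `max_{x ≠ 0} ‖Ax‖_∞ / ‖x‖_p`. -/
noncomputable def opNormInf {m n : ℕ} {𝕜 : Type*} [RCLike 𝕜] (p : ℝ)
    (A : Matrix (Fin m) (Fin n) 𝕜) : ℝ :=
  ⨆ x : {x : Fin n → 𝕜 // x ≠ 0}, linorm (A.mulVec x.1) / lpnorm p x.1

/-- `row A i` is the conjugate transpose of the `i`-th row of `A`,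
so that `(A x) i = ⟨x, row A i⟩` for the standard Hermitian inner product. -/
def row {m n : ℕ} {𝕜 : Type*} [RCLike 𝕜] (A : Matrix (Fin m) (Fin n) 𝕜) (i : Fin m) :
    Fin n → 𝕜 := fun k => star (A i k)

/-- The standard Hermitian inner product `⟨x, y⟩ = ∑ k, x k * conj (y k)`. -/
noncomputable def hinner {n : ℕ} (x y : Fin n → ℂ) : ℂ := ∑ k, x k * star (y k)

section LpNorm

variable {n : ℕ} {𝕜 : Type*} [RCLike 𝕜]

theorem lpnorm_nonneg (p : ℝ) (x : Fin n → 𝕜) : 0 ≤ lpnorm p x := by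
  unfold lpnorm; positivity

theorem lpnorm_rpow {p : ℝ} (hp : p ≠ 0) (x : Fin n → 𝕜) :
    lpnorm p x ^ p = ∑ i, ‖x i‖ ^ p := by
  unfold lpnorm
  rw [← Real.rpow_mul (by positivity), one_div_mul_cancel hp, Real.rpow_one]

theorem norm_le_lpnorm {p : ℝ} (hp : 0 < p) (x : Fin n → 𝕜) (i : Fin n) :
    ‖x i‖ ≤ lpnorm p x := by
  rw [← Real.rpow_le_rpow_iff (norm_nonneg _) (lpnorm_nonneg _ _) hp, lpnorm_rpow hp.ne']
  exact Finset.single_le_sum (f := fun i => ‖x i‖ ^ p) (fun j _ => by positivity)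
    (Finset.mem_univ i)

theorem lpnorm_pos {p : ℝ} (hp : 0 < p) {x : Fin n → 𝕜} (hx : x ≠ 0) : 0 < lpnorm p x := by
  obtain ⟨i, hi⟩ := Function.ne_iff.mp hx
  exact (norm_pos_iff.mpr hi).trans_le (norm_le_lpnorm hp x i)

theorem lpnorm_zero {p : ℝ} (hp : p ≠ 0) : lpnorm p (0 : Fin n → 𝕜) = 0 := by
  simp [lpnorm, hp]

/-- Cauchy–Schwarz. -/
theorem norm_sum_mul_le_lpnorm_two (f g : Fin n → 𝕜) :
    ‖∑ k, f k * g k‖ ≤ lpnorm 2 f * lpnorm 2 g := by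
  refine (norm_sum_le _ _).trans ?_
  simp only [norm_mul]
  exact Real.inner_le_Lp_mul_Lq_of_nonneg _ Real.HolderConjugate.two_two
    (fun i _ => norm_nonneg _) (fun i _ => norm_nonneg _)

/-- Log-convexity of `p ↦ ‖x‖_p` at the exponents `2 < q < 2q`. -/
theorem lpnorm_le_interpolate {q : ℝ} (hq : 2 < q) (x : Fin n → 𝕜) :
    lpnorm q x ≤ lpnorm 2 x ^ (1 / (q - 1)) * lpnorm (2 * q) x ^ ((q - 2) / (q - 1)) := by
  have h1 : 0 < q - 1 := by linarith
  have h2 : 0 < q - 2 := by linarith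
  have hq0 : 0 < q := by linarith
  have hc : (2 * (q - 1) / q).HolderConjugate (2 * (q - 1) / (q - 2)) := by
    rw [Real.holderConjugate_iff]
    refine ⟨?_, ?_⟩
    · rw [lt_div_iff₀ hq0]; linarith
    · field_simp; ring
  have key := Real.inner_le_Lp_mul_Lq_of_nonneg Finset.univ hc
    (f := fun i => ‖x i‖ ^ (q / (q - 1))) (g := fun i => ‖x i‖ ^ (q * (q - 2) / (q - 1)))
    (fun i _ => by positivity) (fun i _ => by positivity)
  have e1 : ∀ i, ‖x i‖ ^ (q / (q - 1)) * ‖x i‖ ^ (q * (q - 2) / (q - 1)) = ‖x i‖ ^ q := by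
    intro i
    rw [← Real.rpow_add_of_nonneg (norm_nonneg _) (by positivity) (by positivity)]
    congr 1; field_simp; ring
  have e2 : ∀ i, (‖x i‖ ^ (q / (q - 1))) ^ (2 * (q - 1) / q) = ‖x i‖ ^ (2 : ℝ) := by
    intro i
    rw [← Real.rpow_mul (norm_nonneg _)]
    congr 1; field_simp
  have e3 : ∀ i, (‖x i‖ ^ (q * (q - 2) / (q - 1))) ^ (2 * (q - 1) / (q - 2))
      = ‖x i‖ ^ (2 * q) := by
    intro i
    rw [← Real.rpow_mul (norm_nonneg _)]
    congr 1; field_simp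
  simp only [e1, e2, e3] at key
  rw [← lpnorm_rpow hq0.ne', ← lpnorm_rpow two_ne_zero, ← lpnorm_rpow (by positivity),
    ← Real.rpow_mul (lpnorm_nonneg _ _), ← Real.rpow_mul (lpnorm_nonneg _ _)] at key
  have n1 := lpnorm_nonneg 2 x
  have n2 := lpnorm_nonneg (2 * q) x
  rw [← Real.rpow_le_rpow_iff (lpnorm_nonneg _ _) (by positivity) hq0,
    Real.mul_rpow (by positivity) (by positivity), ← Real.rpow_mul n1, ← Real.rpow_mul n2]
  convert key using 3 <;> field_simp

theorem lpnorm_two_le_mul_lpnorm {q : ℝ} (hq : 2 ≤ q) (x : Fin n → 𝕜) :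
    lpnorm 2 x ≤ (n : ℝ) ^ (1 / 2 - 1 / q) * lpnorm q x := by
  have hq0 : 0 < q := by linarith
  have key := Real.rpow_sum_le_const_mul_sum_rpow (s := Finset.univ)
    (f := fun i => ‖x i‖ ^ (2 : ℝ)) (p := q / 2) (by linarith)
  have e1 : ∀ i, |‖x i‖ ^ (2 : ℝ)| = ‖x i‖ ^ (2 : ℝ) := fun i => abs_of_nonneg (by positivity)
  have e2 : ∀ i, (‖x i‖ ^ (2 : ℝ)) ^ (q / 2) = ‖x i‖ ^ q := by
    intro i
    rw [← Real.rpow_mul (norm_nonneg _)]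
    congr 1; field_simp
  simp only [e1, e2, Finset.card_univ, Fintype.card_fin] at key
  have n1 := lpnorm_nonneg 2 x
  have n2 := lpnorm_nonneg q x
  rw [← lpnorm_rpow hq0.ne', ← lpnorm_rpow two_ne_zero, ← Real.rpow_mul n1] at key
  rw [← Real.rpow_le_rpow_iff n1 (by positivity) hq0, Real.mul_rpow (by positivity) n2,
    ← Real.rpow_mul (by positivity)]
  convert key using 3 <;> field_simp

end LpNorm

/-- A kernel whose rows and columns have `ℓ_q` norm at most `C` is bounded by `C` as a bilinear
form on `ℓ_p`, where `p` is conjugate to `2q`. -/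
theorem sum_kernel_mul_rpow_le {ι : Type*} [Fintype ι] {q : ℝ} (hq : 1 < q) {C : ℝ} (hC : 0 ≤ C)
    {b : ι → ι → ℝ} (hb : ∀ i j, 0 ≤ b i j) (hrow : ∀ i, ∑ j, b i j ^ q ≤ C ^ q)
    (hcol : ∀ j, ∑ i, b i j ^ q ≤ C ^ q) {a : ι → ℝ} (ha : ∀ i, 0 ≤ a i) :
    ∑ i, ∑ j, b i j * (a i ^ (2 * q - 1) * a j ^ (2 * q - 1))
      ≤ C * (∑ i, a i ^ (2 * q)) ^ (2 - 1 / q) := by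
  have hq0 : 0 < q := by linarith
  have hq1 : 0 < q - 1 := by linarith
  set T := ∑ i, a i ^ (2 * q) with hT
  have hT0 : 0 ≤ T := Finset.sum_nonneg fun i _ => Real.rpow_nonneg (ha i) _
  have hc : q.HolderConjugate (q / (q - 1)) := Real.HolderConjugate.conjExponent hq
  have key := Real.inner_le_Lp_mul_Lq_of_nonneg (Finset.univ : Finset (ι × ι)) hc
    (f := fun w => b w.1 w.2 * (a w.1 * a w.2))
    (g := fun w => a w.1 ^ (2 * q - 2) * a w.2 ^ (2 * q - 2))
    (fun w _ => mul_nonneg (hb _ _) (mul_nonneg (ha _) (ha _)))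
    (fun w _ => mul_nonneg (Real.rpow_nonneg (ha _) _) (Real.rpow_nonneg (ha _) _))
  have e0 : ∀ i, a i * a i ^ (2 * q - 2) = a i ^ (2 * q - 1) := by
    intro i
    rw [← Real.rpow_one_add' (ha i) (by linarith)]
    congr 1; ring
  have e1 : ∀ i j, b i j * (a i * a j) * (a i ^ (2 * q - 2) * a j ^ (2 * q - 2))
      = b i j * (a i ^ (2 * q - 1) * a j ^ (2 * q - 1)) := by
    intro i j
    rw [← e0, ← e0]; ring
  have e2 : ∀ i j, (a i ^ (2 * q - 2) * a j ^ (2 * q - 2)) ^ (q / (q - 1))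
      = a i ^ (2 * q) * a j ^ (2 * q) := by
    intro i j
    rw [Real.mul_rpow (Real.rpow_nonneg (ha _) _) (Real.rpow_nonneg (ha _) _),
      ← Real.rpow_mul (ha _), ← Real.rpow_mul (ha _)]
    congr 2 <;> field_simp
  have e3 : ∀ i j, (b i j * (a i * a j)) ^ q
      ≤ (b i j ^ q * a i ^ (2 * q) + b i j ^ q * a j ^ (2 * q)) / 2 := by
    intro i j
    rw [Real.mul_rpow (hb _ _) (mul_nonneg (ha _) (ha _)), Real.mul_rpow (ha _) (ha _),
      mul_comm 2 q, Real.rpow_mul (ha i), Real.rpow_mul (ha j), Real.rpow_two, Real.rpow_two]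
    have := Real.rpow_nonneg (hb i j) q
    nlinarith [mul_nonneg this (sq_nonneg (a i ^ q - a j ^ q))]
  simp only [Fintype.sum_prod_type, e1, e2] at key
  have hg : ∑ i, ∑ j, a i ^ (2 * q) * a j ^ (2 * q) = T ^ (2 : ℝ) := by
    rw [← Finset.sum_mul_sum, Real.rpow_two, sq]
  have s1 : ∑ i, ∑ j, b i j ^ q * a i ^ (2 * q) ≤ C ^ q * T := by
    rw [hT, Finset.mul_sum]
    refine Finset.sum_le_sum fun i _ => ?_
    rw [← Finset.sum_mul]
    exact mul_le_mul_of_nonneg_right (hrow i) (Real.rpow_nonneg (ha i) _)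
  have s2 : ∑ i, ∑ j, b i j ^ q * a j ^ (2 * q) ≤ C ^ q * T := by
    rw [Finset.sum_comm, hT, Finset.mul_sum]
    refine Finset.sum_le_sum fun i _ => ?_
    rw [← Finset.sum_mul]
    exact mul_le_mul_of_nonneg_right (hcol i) (Real.rpow_nonneg (ha i) _)
  have hf : ∑ i, ∑ j, (b i j * (a i * a j)) ^ q ≤ C ^ q * T := by
    calc _ ≤ ∑ i, ∑ j, (b i j ^ q * a i ^ (2 * q) + b i j ^ q * a j ^ (2 * q)) / 2 :=
          Finset.sum_le_sum fun i _ => Finset.sum_le_sum fun j _ => e3 i j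
      _ = (∑ i, ∑ j, b i j ^ q * a i ^ (2 * q) + ∑ i, ∑ j, b i j ^ q * a j ^ (2 * q)) / 2 := by
          simp only [← Finset.sum_div, Finset.sum_add_distrib]
      _ ≤ _ := by linarith
  have hf0 : 0 ≤ ∑ i, ∑ j, (b i j * (a i * a j)) ^ q :=
    Finset.sum_nonneg fun i _ => Finset.sum_nonneg fun j _ =>
      Real.rpow_nonneg (mul_nonneg (hb _ _) (mul_nonneg (ha _) (ha _))) _
  refine key.trans ?_
  rw [hg, ← Real.rpow_mul hT0]
  calc _ ≤ (C ^ q * T) ^ (1 / q) * T ^ (2 * (1 / (q / (q - 1)))) := by gcongr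
    _ = C * (T ^ (1 / q) * T ^ (2 * (1 / (q / (q - 1))))) := by
        rw [Real.mul_rpow (by positivity) hT0, ← Real.rpow_mul hC, mul_one_div_cancel hq0.ne',
          Real.rpow_one, mul_assoc]
    _ = _ := by
        rw [← Real.rpow_add_of_nonneg hT0 (by positivity) (by positivity)]
        congr 2; field_simp; ring

section Rows

variable {m n : ℕ} (A : Matrix (Fin m) (Fin n) ℂ)

theorem mulVec_row_apply (i j : Fin m) :
    A.mulVec (row A j) i = ∑ k, A i k * star (A j k) := rfl

theorem norm_mulVec_row_comm (i j : Fin m) :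
    ‖A.mulVec (row A j) i‖ = ‖A.mulVec (row A i) j‖ := by
  rw [← norm_star (A.mulVec (row A i) j), mulVec_row_apply, mulVec_row_apply]
  simp [star_sum, mul_comm]

theorem lpnorm_two_row_sq (i : Fin m) :
    lpnorm 2 (row A i) ^ 2 = ‖A.mulVec (row A i) i‖ := by
  have h : A.mulVec (row A i) i = ((∑ k, ‖A i k‖ ^ 2 : ℝ) : ℂ) := by
    rw [mulVec_row_apply]
    push_cast
    exact Finset.sum_congr rfl fun k _ => Complex.mul_conj' _
  rw [h, Complex.norm_real, Real.norm_of_nonneg (by positivity), ← Real.rpow_two,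
    lpnorm_rpow two_ne_zero]
  simp [row]

theorem norm_mulVec_apply_le (x : Fin n → ℂ) (i : Fin m) :
    ‖A.mulVec x i‖ ≤ lpnorm 2 (row A i) * lpnorm 2 x := by
  have h : lpnorm 2 (row A i) = lpnorm 2 (A i) := by simp [lpnorm, row]
  rw [h]
  exact norm_sum_mul_le_lpnorm_two (A i) x

theorem bddAbove_opNorm_two {q : ℝ} (hq : 0 < q) :
    BddAbove (Set.range fun x : {x : Fin n → ℂ // x ≠ 0} =>
      lpnorm q (A.mulVec x.1) / lpnorm 2 x.1) := by
  refine ⟨lpnorm q fun i => lpnorm 2 (row A i), ?_⟩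
  rintro _ ⟨⟨x, hx⟩, rfl⟩
  have hx0 := lpnorm_pos two_pos hx
  have hR := lpnorm_nonneg q fun i => lpnorm 2 (row A i)
  dsimp only
  rw [div_le_iff₀ hx0, ← Real.rpow_le_rpow_iff (lpnorm_nonneg _ _) (mul_nonneg hR hx0.le) hq,
    Real.mul_rpow hR hx0.le, lpnorm_rpow hq.ne', lpnorm_rpow hq.ne', Finset.sum_mul]
  refine Finset.sum_le_sum fun i _ => ?_
  rw [Real.norm_of_nonneg (lpnorm_nonneg _ _), ← Real.mul_rpow (lpnorm_nonneg _ _) hx0.le]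
  exact Real.rpow_le_rpow (norm_nonneg _) (norm_mulVec_apply_le A x i) hq.le

/-- If `‖A r‖_q ≤ M ‖r‖_2` for every row `r` and every row has norm at most `M`,
then `‖A‖_{2 → 2q} ≤ M`. -/
theorem lpnorm_two_mul_mulVec_le {q : ℝ} (hq : 1 < q) {M : ℝ}
    (hrow : ∀ i, lpnorm 2 (row A i) ≤ M)
    (hArow : ∀ i, lpnorm q (A.mulVec (row A i)) ≤ M * lpnorm 2 (row A i)) (hM : 0 ≤ M)
    (x : Fin n → ℂ) :
    lpnorm (2 * q) (A.mulVec x) ≤ M * lpnorm 2 x := by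
  have hq0 : 0 < q := by linarith
  set y := A.mulVec x with hy
  set T := ∑ i, ‖y i‖ ^ (2 * q) with hT
  have hT0 : 0 ≤ T := by positivity
  have hx0 := lpnorm_nonneg 2 x
  let z : Fin m → ℂ := fun i => ((‖y i‖ ^ (2 * q - 2) : ℝ) : ℂ) * star (y i)
  let c : Fin n → ℂ := fun k => ∑ i, z i * A i k
  have hz : ∀ i, ‖z i‖ = ‖y i‖ ^ (2 * q - 1) := by
    intro i
    rw [norm_mul, norm_star, Complex.norm_real, Real.norm_of_nonneg (by positivity),
      ← Real.rpow_add_one' (norm_nonneg _) (by linarith)]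
    congr 1; ring
  have hzy : ∀ i, z i * y i = ((‖y i‖ ^ (2 * q) : ℝ) : ℂ) := by
    intro i
    have h : star (y i) * y i = ((‖y i‖ ^ 2 : ℝ) : ℂ) := by
      push_cast; exact Complex.conj_mul' _
    rw [mul_assoc, h, ← Complex.ofReal_mul, ← Real.rpow_two,
      ← Real.rpow_add_of_nonneg (norm_nonneg _) (by linarith) (by norm_num)]
    congr 2; ring
  have hTc : T ≤ lpnorm 2 c * lpnorm 2 x := by
    have h : ((T : ℝ) : ℂ) = ∑ k, c k * x k := by
      calc ((T : ℝ) : ℂ) = ∑ i, z i * y i := by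
            rw [hT, Complex.ofReal_sum]; exact Finset.sum_congr rfl fun i _ => (hzy i).symm
        _ = ∑ i, ∑ k, z i * (A i k * x k) := by
            refine Finset.sum_congr rfl fun i _ => ?_
            rw [← Finset.mul_sum]; rfl
        _ = ∑ k, ∑ i, z i * (A i k * x k) := Finset.sum_comm
        _ = _ := by
            refine Finset.sum_congr rfl fun k _ => ?_
            rw [Finset.sum_mul]; exact Finset.sum_congr rfl fun i _ => (mul_assoc _ _ _).symm
    calc T = ‖((T : ℝ) : ℂ)‖ := by rw [Complex.norm_real, Real.norm_of_nonneg hT0]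
      _ ≤ _ := by rw [h]; exact norm_sum_mul_le_lpnorm_two c x
  have hc : lpnorm 2 c ^ 2 ≤ ∑ i, ∑ j, ‖A.mulVec (row A j) i‖ *
      (‖y i‖ ^ (2 * q - 1) * ‖y j‖ ^ (2 * q - 1)) := by
    have h : ((lpnorm 2 c ^ 2 : ℝ) : ℂ) =
        ∑ i, ∑ j, A.mulVec (row A j) i * (z i * star (z j)) := by
      rw [← Real.rpow_two, lpnorm_rpow two_ne_zero]
      simp only [Real.rpow_two]
      calc ((∑ k, ‖c k‖ ^ 2 : ℝ) : ℂ) = ∑ k, c k * star (c k) := by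
            push_cast; exact Finset.sum_congr rfl fun k _ => (Complex.mul_conj' _).symm
        _ = ∑ k, ∑ i, ∑ j, A i k * star (A j k) * (z i * star (z j)) := by
            refine Finset.sum_congr rfl fun k _ => ?_
            rw [star_sum, Finset.sum_mul_sum]
            refine Finset.sum_congr rfl fun i _ => Finset.sum_congr rfl fun j _ => ?_
            rw [star_mul']; ring
        _ = _ := by
            rw [Finset.sum_comm]
            refine Finset.sum_congr rfl fun i _ => ?_
            rw [Finset.sum_comm]
            refine Finset.sum_congr rfl fun j _ => ?_
            rw [mulVec_row_apply, Finset.sum_mul]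
    calc lpnorm 2 c ^ 2 = ‖((lpnorm 2 c ^ 2 : ℝ) : ℂ)‖ := by
          rw [Complex.norm_real, Real.norm_of_nonneg (by positivity)]
      _ ≤ ∑ i, ∑ j, ‖A.mulVec (row A j) i * (z i * star (z j))‖ := by
          rw [h]
          exact (norm_sum_le _ _).trans (Finset.sum_le_sum fun i _ => norm_sum_le _ _)
      _ = _ := by simp only [norm_mul, norm_star, hz]
  have hcol : ∀ j, ∑ i, ‖A.mulVec (row A j) i‖ ^ q ≤ (M ^ 2) ^ q := by
    intro j
    rw [← lpnorm_rpow hq0.ne']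
    refine Real.rpow_le_rpow (lpnorm_nonneg _ _) ((hArow j).trans ?_) hq0.le
    rw [sq]
    exact mul_le_mul_of_nonneg_left (hrow j) hM
  have hker := sum_kernel_mul_rpow_le hq (sq_nonneg M)
    (b := fun i j => ‖A.mulVec (row A j) i‖) (fun _ _ => norm_nonneg _)
    (fun i => by simpa only [norm_mulVec_row_comm A i] using hcol i) hcol
    (a := fun i => ‖y i‖) (fun _ => norm_nonneg _)
  have hTT : T ^ 2 ≤ (M * lpnorm 2 x) ^ 2 * T ^ (2 - 1 / q) := by
    calc T ^ 2 ≤ (lpnorm 2 c * lpnorm 2 x) ^ 2 := by gcongr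
      _ = lpnorm 2 c ^ 2 * lpnorm 2 x ^ 2 := by ring
      _ ≤ (M ^ 2 * T ^ (2 - 1 / q)) * lpnorm 2 x ^ 2 := by
          gcongr; exact hc.trans hker
      _ = _ := by ring
  rcases hT0.eq_or_lt with h0 | hpos
  · have : lpnorm (2 * q) y = 0 := by
      unfold lpnorm
      rw [← hT, ← h0, Real.zero_rpow (by positivity)]
    rw [this]; positivity
  · have h : T ^ (1 / q) ≤ (M * lpnorm 2 x) ^ 2 := by
      have hp : 0 < T ^ (2 - 1 / q) := Real.rpow_pos_of_pos hpos _
      refine le_of_mul_le_mul_right ?_ hp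
      rwa [← Real.rpow_add hpos, add_sub_cancel, Real.rpow_two]
    refine (sq_le_sq₀ (lpnorm_nonneg _ _) (mul_nonneg hM hx0)).mp ?_
    have e : lpnorm (2 * q) y ^ 2 = T ^ (1 / q) := by
      unfold lpnorm
      rw [← hT, ← Real.rpow_two, ← Real.rpow_mul hT0]
      congr 1; field_simp
    rwa [e]

end Rows

theorem stmt1 {m n : ℕ} (q : ℝ) (hq : 2 ≤ q) (A : Matrix (Fin m) (Fin n) ℂ) (hA : A ≠ 0)
    (v : Fin n → ℂ) (hv : v ≠ 0)
    (hsv : lpnorm 2 (A.mulVec v) = opNorm 2 2 A * lpnorm 2 v)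
    (M : ℝ)
    (hM : M = sSup {t : ℝ | ∃ x ∈ insert v (Set.range (row A)), x ≠ 0 ∧
      t = lpnorm q (A.mulVec x) / lpnorm 2 x}) :
    M ≥ (2 * (m : ℝ) ^ (1 / q)) ^ (-((q - 2) / (2 * (q - 1)))) * opNorm 2 q A := by
  have hq0 : 0 < q := by linarith
  have hfin : {t : ℝ | ∃ x ∈ insert v (Set.range (row A)), x ≠ 0 ∧
      t = lpnorm q (A.mulVec x) / lpnorm 2 x}.Finite := by
    refine (((Set.finite_range (row A)).insert v).image
      fun x => lpnorm q (A.mulVec x) / lpnorm 2 x).subset ?_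
    rintro t ⟨x, hx, -, rfl⟩
    exact ⟨x, hx, rfl⟩
  have hmem : ∀ x ∈ insert v (Set.range (row A)), x ≠ 0 →
      lpnorm q (A.mulVec x) / lpnorm 2 x ≤ M := fun x hx hx0 =>
    hM ▸ le_csSup hfin.bddAbove ⟨x, hx, hx0, rfl⟩
  have hvM := hmem v (Set.mem_insert _ _) hv
  have hv0 := lpnorm_pos two_pos hv
  have hM0 : 0 ≤ M := (div_nonneg (lpnorm_nonneg _ _) (lpnorm_nonneg _ _)).trans hvM
  have hm : 0 < (m : ℝ) := by
    rcases Nat.eq_zero_or_pos m with rfl | h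
    · exact absurd (Subsingleton.elim A 0) hA
    · exact_mod_cast h
  have hσ : opNorm 2 2 A ≤ (m : ℝ) ^ (1 / 2 - 1 / q) * M := by
    rw [div_le_iff₀ hv0] at hvM
    refine le_of_mul_le_mul_right ?_ hv0
    rw [← hsv, mul_assoc]
    exact (lpnorm_two_le_mul_lpnorm hq _).trans
      (mul_le_mul_of_nonneg_left hvM (by positivity))
  have hAr : ∀ i, lpnorm q (A.mulVec (row A i)) ≤ M * lpnorm 2 (row A i) := by
    intro i
    by_cases h : row A i = 0
    · rw [h, Matrix.mulVec_zero, lpnorm_zero hq0.ne', lpnorm_zero two_ne_zero, mul_zero]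
    · exact (div_le_iff₀ (lpnorm_pos two_pos h)).mp (hmem _ (Or.inr ⟨i, rfl⟩) h)
  have hr : ∀ i, lpnorm 2 (row A i) ≤ M := by
    intro i
    by_cases h : row A i = 0
    · rwa [h, lpnorm_zero two_ne_zero]
    · refine le_of_mul_le_mul_right ?_ (lpnorm_pos two_pos h)
      rw [← sq, lpnorm_two_row_sq]
      exact (norm_le_lpnorm hq0 _ i).trans (hAr i)
  have : Nonempty {x : Fin n → ℂ // x ≠ 0} := ⟨⟨v, hv⟩⟩
  have hN : opNorm 2 q A ≤ (m : ℝ) ^ (1 / q * ((q - 2) / (2 * (q - 1)))) * M := by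
    rcases hq.eq_or_lt with rfl | hq2
    · simpa using hσ
    have hq1 : 0 < q - 1 := by linarith
    have hq2' : 0 < q - 2 := by linarith
    refine ciSup_le ?_
    rintro ⟨x, hx⟩
    have hx0 := lpnorm_pos two_pos hx
    rw [div_le_iff₀ hx0]
    have h2 : lpnorm 2 (A.mulVec x) ≤ (m : ℝ) ^ (1 / 2 - 1 / q) * (M * lpnorm 2 x) := by
      rw [← mul_assoc, ← div_le_iff₀ hx0]
      exact (le_ciSup (bddAbove_opNorm_two A two_pos) ⟨x, hx⟩).trans hσ
    have h2q := lpnorm_two_mul_mulVec_le A (by linarith) hr hAr hM0 x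
    have n1 := lpnorm_nonneg 2 (A.mulVec x)
    have n2 := lpnorm_nonneg (2 * q) (A.mulVec x)
    have hMx : 0 ≤ M * lpnorm 2 x := by positivity
    calc lpnorm q (A.mulVec x) ≤ _ := lpnorm_le_interpolate hq2 _
      _ ≤ ((m : ℝ) ^ (1 / 2 - 1 / q) * (M * lpnorm 2 x)) ^ (1 / (q - 1)) *
          (M * lpnorm 2 x) ^ ((q - 2) / (q - 1)) := by gcongr
      _ = (m : ℝ) ^ ((1 / 2 - 1 / q) * (1 / (q - 1))) *
          ((M * lpnorm 2 x) ^ (1 / (q - 1)) * (M * lpnorm 2 x) ^ ((q - 2) / (q - 1))) := by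
          rw [Real.mul_rpow (by positivity) hMx, ← Real.rpow_mul hm.le, mul_assoc]
      _ = (m : ℝ) ^ (1 / q * ((q - 2) / (2 * (q - 1)))) * (M * lpnorm 2 x) := by
          rw [← Real.rpow_add_of_nonneg hMx (by positivity) (by positivity)]
          have e1 : 1 / (q - 1) + (q - 2) / (q - 1) = 1 := by field_simp; ring
          rw [e1, Real.rpow_one]
          congr 2; field_simp
      _ = _ := (mul_assoc _ _ _).symm
  have he : 0 ≤ (q - 2) / (2 * (q - 1)) := div_nonneg (by linarith) (by linarith)
  rw [ge_iff_le, Real.rpow_neg (by positivity), inv_mul_le_iff₀ (by positivity)]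
  refine hN.trans (mul_le_mul_of_nonneg_right ?_ hM0)
  rw [Real.rpow_mul hm.le]
  refine Real.rpow_le_rpow (by positivity) ?_ he
  have : 0 ≤ (m : ℝ) ^ (1 / q) := by positivity
  linarith
end

section
/- Let A ∈ ℂ^{m×n} be a matrix, q ≥ 2 a real number, r_1,…,r_m ∈ ℂ^n the conjugate transposes of the m rows of A, and let w ∈ ℂ^n satisfy ‖w‖_2 = 1 and ‖Aw‖_q = ‖A‖_{2→q}. Then for any k with r_k ≠ 0, ‖Ar_k‖_q/‖r_k‖_2 ≥ (|⟨w, r_k⟩|/(2‖r_k‖_2)) · ‖A‖_{2→q}. -/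
open scoped BigOperators

open scoped InnerProductSpace in
/-- If a bounded operator on a Hilbert space attains its norm at a unit vector `w`, then
`‖T v‖ ≥ |⟪w, v⟫| * ‖T w‖` for every `v`. -/
theorem norm_inner_mul_le_norm_apply_of_norm_attained {𝕜 E F : Type*} [RCLike 𝕜]
    [NormedAddCommGroup E] [InnerProductSpace 𝕜 E] [CompleteSpace E]
    [NormedAddCommGroup F] [NormedSpace 𝕜 F] (T : E →L[𝕜] F) {w : E} (hw : ‖w‖ = 1)
    (hT : ∀ x, ‖T x‖ ≤ ‖T w‖ * ‖x‖) (v : E) : ‖⟪w, v⟫_𝕜‖ * ‖T w‖ ≤ ‖T v‖ := by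
  obtain ⟨f, hf, hfw⟩ := exists_dual_vector'' 𝕜 (T w)
  have hf_le (y : F) : ‖f y‖ ≤ ‖y‖ := f.le_of_opNorm_le_of_le hf le_rfl |>.trans_eq (one_mul _)
  let z : E := (InnerProductSpace.toDual 𝕜 E).symm (f.comp T)
  have hz (x : E) : ⟪z, x⟫_𝕜 = f (T x) := InnerProductSpace.toDual_symm_apply
  have hz_norm : ‖z‖ ≤ ‖T w‖ := by
    rw [LinearIsometryEquiv.norm_map]
    exact (f.comp T).opNorm_le_bound (norm_nonneg _) fun x => (hf_le _).trans (hT x)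
  have hzw : z = (‖T w‖ : 𝕜) • w := by
    have h := @norm_sub_sq 𝕜 E _ _ _ z ((‖T w‖ : 𝕜) • w)
    rw [inner_smul_right, hz, hfw, norm_smul, hw, ← RCLike.ofReal_mul, RCLike.ofReal_re,
      RCLike.norm_ofReal, abs_of_nonneg (norm_nonneg _)] at h
    have h_sq : ‖z‖ ^ 2 ≤ ‖T w‖ ^ 2 := by gcongr
    have : ‖z - (‖T w‖ : 𝕜) • w‖ ^ 2 = 0 := le_antisymm (by nlinarith) (sq_nonneg _)
    simpa [sub_eq_zero] using this
  calc ‖⟪w, v⟫_𝕜‖ * ‖T w‖ = ‖⟪z, v⟫_𝕜‖ := by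
        rw [hzw, inner_smul_left, norm_mul, RCLike.norm_conj, RCLike.norm_ofReal,
          abs_of_nonneg (norm_nonneg _), mul_comm]
    _ ≤ ‖T v‖ := hz v ▸ hf_le _

theorem lpnorm_eq_norm_toLp {n : ℕ} {𝕜 : Type*} [RCLike 𝕜] {p : ℝ} (hp : 0 < p)
    (x : Fin n → 𝕜) : lpnorm p x = ‖WithLp.toLp (ENNReal.ofReal p) x‖ := by
  have h : (ENNReal.ofReal p).toReal = p := ENNReal.toReal_ofReal hp.le
  rw [PiLp.norm_eq_sum (by rwa [h]), h, lpnorm]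

theorem lpnorm_two_eq_norm_toLp {n : ℕ} {𝕜 : Type*} [RCLike 𝕜] (x : Fin n → 𝕜) :
    lpnorm 2 x = ‖WithLp.toLp 2 x‖ := by
  rw [PiLp.norm_eq_sum (by simp), ENNReal.toReal_ofNat, lpnorm]

theorem hinner_eq_inner_toLp {n : ℕ} (x y : Fin n → ℂ) :
    hinner x y = inner ℂ (WithLp.toLp 2 y) (WithLp.toLp 2 x) := by
  simp [hinner, PiLp.inner_apply]

/-- A matrix as a bounded operator from the Euclidean norm to the `ℓ_p` norm. -/
noncomputable def matrixToLpCLM {m n : ℕ} (p : ENNReal) [Fact (1 ≤ p)]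
    (A : Matrix (Fin m) (Fin n) ℂ) :
    EuclideanSpace ℂ (Fin n) →L[ℂ] PiLp p (fun _ : Fin m => ℂ) :=
  LinearMap.toContinuousLinearMap
    ((WithLp.linearEquiv p ℂ (Fin m → ℂ)).symm.toLinearMap ∘ₗ A.mulVecLin ∘ₗ
      (WithLp.linearEquiv 2 ℂ (Fin n → ℂ)).toLinearMap)

theorem norm_matrixToLpCLM_toLp {m n : ℕ} {q : ℝ} (hq : 0 < q)
    [Fact (1 ≤ ENNReal.ofReal q)] (A : Matrix (Fin m) (Fin n) ℂ) (x : Fin n → ℂ) :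
    ‖matrixToLpCLM (ENNReal.ofReal q) A (WithLp.toLp 2 x)‖ = lpnorm q (A.mulVec x) :=
  (lpnorm_eq_norm_toLp hq _).symm

theorem lpnorm_mulVec_le_opNorm_two {m n : ℕ} {q : ℝ} (hq : 1 ≤ q)
    (A : Matrix (Fin m) (Fin n) ℂ) (x : Fin n → ℂ) :
    lpnorm q (A.mulVec x) ≤ opNorm 2 q A * lpnorm 2 x := by
  have : Fact (1 ≤ ENNReal.ofReal q) := ⟨by simpa using hq⟩
  have hq₀ : 0 < q := by linarith
  obtain rfl | hx := eq_or_ne x 0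
  · rw [lpnorm_eq_norm_toLp hq₀, lpnorm_two_eq_norm_toLp]
    simp
  have h_pos : 0 < lpnorm 2 x := by
    rw [lpnorm_two_eq_norm_toLp]
    simpa using hx
  rw [← div_le_iff₀ h_pos]
  refine le_ciSup (f := fun x : {x : Fin n → ℂ // x ≠ 0} =>
    lpnorm q (A.mulVec x.1) / lpnorm 2 x.1) ⟨‖matrixToLpCLM (ENNReal.ofReal q) A‖, ?_⟩ ⟨x, hx⟩
  rintro _ ⟨y, rfl⟩
  dsimp only
  rw [← norm_matrixToLpCLM_toLp hq₀, lpnorm_two_eq_norm_toLp]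
  exact ContinuousLinearMap.ratio_le_opNorm _ _

/-- If `‖A‖_{2→q}` is attained at the unit vector `w`, then
`‖Av‖_q ≥ |⟨w, v⟩| * ‖A‖_{2→q}` for every `v`. -/
theorem norm_hinner_mul_opNorm_two_le {m n : ℕ} {q : ℝ} (hq : 1 ≤ q)
    (A : Matrix (Fin m) (Fin n) ℂ) {w : Fin n → ℂ} (hw : lpnorm 2 w = 1)
    (hw2 : lpnorm q (A.mulVec w) = opNorm 2 q A) (v : Fin n → ℂ) :
    ‖hinner w v‖ * opNorm 2 q A ≤ lpnorm q (A.mulVec v) := by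
  have : Fact (1 ≤ ENNReal.ofReal q) := ⟨by simpa using hq⟩
  have hq₀ : 0 < q := by linarith
  have h := norm_inner_mul_le_norm_apply_of_norm_attained
    (matrixToLpCLM (ENNReal.ofReal q) A) (w := WithLp.toLp 2 w)
    (by rwa [← lpnorm_two_eq_norm_toLp]) (fun x => ?_) (WithLp.toLp 2 v)
  · rwa [norm_inner_symm, ← hinner_eq_inner_toLp, norm_matrixToLpCLM_toLp hq₀,
      norm_matrixToLpCLM_toLp hq₀, hw2] at h
  · obtain ⟨x⟩ := x
    rw [norm_matrixToLpCLM_toLp hq₀, norm_matrixToLpCLM_toLp hq₀, hw2,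
      ← lpnorm_two_eq_norm_toLp]
    exact lpnorm_mulVec_le_opNorm_two hq A x

theorem stmt8 {m n : ℕ} (q : ℝ) (hq : 2 ≤ q) (A : Matrix (Fin m) (Fin n) ℂ)
    (w : Fin n → ℂ) (hw : lpnorm 2 w = 1) (hw2 : lpnorm q (A.mulVec w) = opNorm 2 q A)
    (k : Fin m) (hk : row A k ≠ 0) :
    lpnorm q (A.mulVec (row A k)) / lpnorm 2 (row A k) ≥
      ‖hinner w (row A k)‖ / (2 * lpnorm 2 (row A k)) * opNorm 2 q A := by
  have h := norm_hinner_mul_opNorm_two_le (by linarith) A hw hw2 (row A k)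
  have h_pos : 0 < lpnorm 2 (row A k) := by
    rw [lpnorm_two_eq_norm_toLp]
    simpa using hk
  have h_nonneg : 0 ≤ ‖hinner w (row A k)‖ * opNorm 2 q A := by
    rw [← hw2, lpnorm]
    positivity
  rw [ge_iff_le, div_mul_eq_mul_div, div_le_div_iff₀ (by positivity) h_pos]
  nlinarith
end
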